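/- arXiv:1801.07452 — 6 statements merged into one kernel-verified Lean document; each statement's English description precedes it below -/
import Mathlib

section
/- Let n be a positive integer and let T be a real symmetric n×n matrix with eigendecomposition T = U_T Diag(t) U_Tᵀ, where U_T is an orthogonal matrix and t ∈ ℝⁿ is a vector of eigenvalues of T. Let f and g₀ be the spectral functions on S_n associated with proper lower-semicontinuous functions φ : ℝⁿ → (−∞,+∞] and ψ : ℝⁿ → (−∞,+∞], respectively. Assume dom φ ∩ dom ψ ≠ ∅ and that the function d ↦ φ(d) − dᵀt + ψ(d) is coercive on ℝⁿ (it tends to +∞ as ‖d‖ → +∞). Then the problem of minimizing C ↦ f(C) − tr(TC) + g₀(C) over S_n has a solution; moreover, the function d ↦ φ(d) − dᵀt + ψ(d) attains its minimum over ℝⁿ at some d̂, and for every such minimizer d̂ the matrix Ĉ = U_T Diag(d̂) U_Tᵀ is a solution of the matrix problem, with f(Ĉ) − tr(TĈ) + g₀(Ĉ) = φ(d̂) − d̂ᵀt + ψ(d̂). -/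
open Matrix Filter Topology Set

noncomputable section

/-- A real matrix is orthogonal. -/
def IsOrth {n : ℕ} (U : Matrix (Fin n) (Fin n) ℝ) : Prop := Uᵀ * U = 1

/-- `d` is a vector of eigenvalues of `C`, i.e. `C = U Diag(d) Uᵀ` for some orthogonal `U`. -/
def IsEigVec {n : ℕ} (C : Matrix (Fin n) (Fin n) ℝ) (d : Fin n → ℝ) : Prop :=
  ∃ U : Matrix (Fin n) (Fin n) ℝ, IsOrth U ∧ C = U * Matrix.diagonal d * Uᵀ

/-- Invariance under permutations of coordinates. -/
def PermInv {n : ℕ} (φ : (Fin n → ℝ) → EReal) : Prop :=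
  ∀ (σ : Equiv.Perm (Fin n)) (d : Fin n → ℝ), φ (d ∘ σ) = φ d

/-- `F` is the spectral function on symmetric matrices associated with `φ`. -/
def IsSpectral {n : ℕ} (F : Matrix (Fin n) (Fin n) ℝ → EReal)
    (φ : (Fin n → ℝ) → EReal) : Prop :=
  PermInv φ ∧ ∀ (C : Matrix (Fin n) (Fin n) ℝ) (d : Fin n → ℝ), IsEigVec C d → F C = φ d

/-- A function with values in (−∞,+∞] (represented in `EReal`, so it never takes the value ⊥)
which is finite somewhere. -/
def IsProper {α : Type*} (φ : α → EReal) : Prop := (∃ x, φ x ≠ ⊤) ∧ ∀ x, φ x ≠ ⊥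

/-- Convexity for extended-real-valued functions. -/
def EConvex {E : Type*} [AddCommGroup E] [Module ℝ E] (φ : E → EReal) : Prop :=
  ∀ (x y : E) (a b : ℝ), 0 ≤ a → 0 ≤ b → a + b = 1 →
    φ (a • x + b • y) ≤ (a : EReal) * φ x + (b : EReal) * φ y

/-- The class Γ₀ : proper, lower semicontinuous, convex functions into (−∞,+∞]. -/
def Gamma0 {E : Type*} [AddCommGroup E] [Module ℝ E] [TopologicalSpace E]
    (φ : E → EReal) : Prop :=
  IsProper φ ∧ LowerSemicontinuous φ ∧ EConvex φ

/-- Squared Frobenius norm. -/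
def frobSq {n : ℕ} (A : Matrix (Fin n) (Fin n) ℝ) : ℝ := ∑ i, ∑ j, (A i j) ^ 2

/-- Frobenius norm. -/
def frobNorm {n : ℕ} (A : Matrix (Fin n) (Fin n) ℝ) : ℝ := Real.sqrt (frobSq A)


theorem aux_min {n : ℕ} (t : Fin n → ℝ) (φ ψ : (Fin n → ℝ) → EReal)
    (hφp : IsProper φ) (hψp : IsProper ψ)
    (hφl : LowerSemicontinuous φ) (hψl : LowerSemicontinuous ψ)
    (hdom : ∃ x : Fin n → ℝ, φ x ≠ ⊤ ∧ ψ x ≠ ⊤)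
    (hcoer : ∀ M : ℝ, ∃ R : ℝ, ∀ d : Fin n → ℝ, R ≤ ‖d‖ →
      (M : EReal) ≤ φ d - ((∑ i, d i * t i : ℝ) : EReal) + ψ d) :
    ∃ dhat : Fin n → ℝ, ∀ d : Fin n → ℝ,
        φ dhat - ((∑ i, dhat i * t i : ℝ) : EReal) + ψ dhat
          ≤ φ d - ((∑ i, d i * t i : ℝ) : EReal) + ψ d := by
  obtain ⟨x, hx1, hx2⟩ := hdom
  have hlin : LowerSemicontinuous (fun d : Fin n → ℝ => ((-(∑ i, d i * t i) : ℝ) : EReal)) := by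
    apply Continuous.lowerSemicontinuous
    exact continuous_coe_real_ereal.comp (by fun_prop)
  have h1 : LowerSemicontinuous
      (fun d : Fin n → ℝ => φ d + ((-(∑ i, d i * t i) : ℝ) : EReal)) := by
    refine hφl.add' hlin fun d => EReal.continuousAt_add (Or.inr ?_) (Or.inr ?_)
    · exact EReal.coe_ne_bot _
    · exact EReal.coe_ne_top _
  have h2 : LowerSemicontinuous
      (fun d : Fin n → ℝ => φ d - ((∑ i, d i * t i : ℝ) : EReal) + ψ d) := by
    simp only [sub_eq_add_neg, ← EReal.coe_neg]
    refine h1.add' hψl fun d => EReal.continuousAt_add (Or.inr (hψp.2 d)) (Or.inl ?_)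
    simp only [ne_eq, EReal.add_eq_bot_iff, not_or]
    exact ⟨hφp.2 d, EReal.coe_ne_bot _⟩
  have hne : φ x - ((∑ i, x i * t i : ℝ) : EReal) + ψ x ≠ ⊤ := by
    rw [sub_eq_add_neg, ← EReal.coe_neg]
    exact EReal.add_ne_top (EReal.add_ne_top hx1 (EReal.coe_ne_top _)) hx2
  obtain ⟨R, hR⟩ := hcoer (φ x - ((∑ i, x i * t i : ℝ) : EReal) + ψ x).toReal
  obtain ⟨a, ha, hmin⟩ := LowerSemicontinuousOn.exists_isMinOn
    (s := Metric.closedBall (0 : Fin n → ℝ) (max R ‖x‖)) ⟨x, by simp⟩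
    (isCompact_closedBall _ _) (h2.lowerSemicontinuousOn _)
  refine ⟨a, fun d => ?_⟩
  by_cases hd : d ∈ Metric.closedBall (0 : Fin n → ℝ) (max R ‖x‖)
  · exact hmin hd
  · have hd' : R ≤ ‖d‖ := by
      simp only [mem_closedBall_zero_iff, not_le] at hd
      exact (le_max_left _ _).trans hd.le
    exact (hmin (show x ∈ _ by simp)).trans ((EReal.le_coe_toReal hne).trans (hR d hd'))

theorem aux_birk {n : ℕ} (W : Matrix (Fin n) (Fin n) ℝ) (h1 : Wᵀ * W = 1) (t d : Fin n → ℝ) :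
    ∃ σ : Equiv.Perm (Fin n), ∑ i, ∑ j, W i j ^ 2 * t i * d j ≤ ∑ i, d (σ i) * t i := by
  have h2 : W * Wᵀ = 1 := mul_eq_one_comm.mp h1
  have hM : (Matrix.of fun i j => W i j ^ 2) ∈ doublyStochastic ℝ (Fin n) := by
    rw [mem_doublyStochastic_iff_sum]
    refine ⟨fun i j => sq_nonneg _, fun i => ?_, fun j => ?_⟩
    · have := congrFun (congrFun h2 i) i
      simpa [Matrix.mul_apply, sq] using this
    · have := congrFun (congrFun h1 j) j
      simpa [Matrix.mul_apply, sq] using this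
  obtain ⟨w, hw0, hw1, hw⟩ := exists_eq_sum_perm_of_mem_doublyStochastic hM
  obtain ⟨σ, -, hσ⟩ := Finset.exists_max_image Finset.univ
    (fun σ : Equiv.Perm (Fin n) => ∑ i, d (σ i) * t i) ⟨1, Finset.mem_univ _⟩
  refine ⟨σ, ?_⟩
  have e : ∑ i, ∑ j, W i j ^ 2 * t i * d j
      = ∑ τ : Equiv.Perm (Fin n), w τ * ∑ i, d (τ i) * t i := by
    have hij : ∀ i j, W i j ^ 2 = ∑ τ : Equiv.Perm (Fin n), w τ * τ.permMatrix ℝ i j := by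
      intro i j
      have := congrFun (congrFun hw i) j
      simpa [Matrix.sum_apply] using this.symm
    simp only [hij, Finset.sum_mul, Finset.mul_sum]
    have : ∀ i, ∑ j, ∑ τ : Equiv.Perm (Fin n), w τ * τ.permMatrix ℝ i j * t i * d j
        = ∑ τ : Equiv.Perm (Fin n), w τ * (d (τ i) * t i) := by
      intro i
      rw [Finset.sum_comm]
      refine Finset.sum_congr rfl fun τ _ => ?_
      rw [Finset.sum_eq_single (τ i)]
      · simp [Equiv.Perm.permMatrix, PEquiv.toMatrix_apply]; ring
      · intro j _ hj
        simp [Equiv.Perm.permMatrix, PEquiv.toMatrix_apply, hj.symm]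
      · simp
    simp only [this]
    exact Finset.sum_comm
  rw [e]
  calc _ ≤ ∑ τ : Equiv.Perm (Fin n), w τ * ∑ i, d (σ i) * t i :=
        Finset.sum_le_sum fun τ _ =>
          mul_le_mul_of_nonneg_left (hσ τ (Finset.mem_univ _)) (hw0 τ)
    _ = _ := by rw [← Finset.sum_mul, hw1, one_mul]

theorem aux_trace {n : ℕ} (U V : Matrix (Fin n) (Fin n) ℝ) (t d : Fin n → ℝ) :
    ((U * diagonal t * Uᵀ) * (V * diagonal d * Vᵀ)).trace
      = ∑ i, ∑ j, (Uᵀ * V) i j ^ 2 * t i * d j := by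
  have : ((U * diagonal t * Uᵀ) * (V * diagonal d * Vᵀ)).trace
      = (diagonal t * (Uᵀ * V) * (diagonal d * (Uᵀ * V)ᵀ)).trace := by
    rw [Matrix.transpose_mul, Matrix.transpose_transpose, Matrix.mul_assoc U, Matrix.mul_assoc U,
      Matrix.trace_mul_comm]
    simp only [Matrix.mul_assoc]
  rw [this]
  simp only [Matrix.trace, Matrix.diag, Matrix.mul_apply (M := diagonal t * (Uᵀ * V)),
    Matrix.diagonal_mul, Matrix.transpose_apply (Uᵀ * V)]
  refine Finset.sum_congr rfl fun i _ => Finset.sum_congr rfl fun j _ => by ring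

theorem aux_spec {n : ℕ} (C : Matrix (Fin n) (Fin n) ℝ) (hC : C.IsSymm) :
    ∃ d, IsEigVec C d := by
  have hH : C.IsHermitian := by
    rw [Matrix.IsHermitian, Matrix.conjTranspose_eq_transpose_of_trivial]; exact hC
  refine ⟨hH.eigenvalues, hH.eigenvectorUnitary, ?_, ?_⟩
  · have := Unitary.coe_star_mul_self hH.eigenvectorUnitary
    rwa [Matrix.star_eq_conjTranspose, Matrix.conjTranspose_eq_transpose_of_trivial] at this
  · have := hH.spectral_theorem
    rw [Unitary.conjStarAlgAut_apply, Matrix.star_eq_conjTranspose,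
      Matrix.conjTranspose_eq_transpose_of_trivial] at this
    exact this

/-- Theorem 1 of the paper. If `f`, `g₀` are the spectral functions associated
with proper lsc `φ`, `ψ`, `T = U Diag(t) Uᵀ` with `U` orthogonal, `dom φ ∩ dom ψ ≠ ∅`, and
`d ↦ φ(d) − dᵀt + ψ(d)` is coercive, then this vector function attains its minimum, and for every
minimizer `d̂`, the matrix `U Diag(d̂) Uᵀ` solves the matrix problem, with equal optimal values. -/
theorem stmt0 (n : ℕ) (hn : 0 < n)
    (T U : Matrix (Fin n) (Fin n) ℝ) (t : Fin n → ℝ)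
    (hT : T.IsSymm) (hU : IsOrth U) (hTdec : T = U * Matrix.diagonal t * Uᵀ)
    (f g₀ : Matrix (Fin n) (Fin n) ℝ → EReal) (φ ψ : (Fin n → ℝ) → EReal)
    (hφp : IsProper φ) (hψp : IsProper ψ)
    (hφl : LowerSemicontinuous φ) (hψl : LowerSemicontinuous ψ)
    (hf : IsSpectral f φ) (hg : IsSpectral g₀ ψ)
    (hdom : ∃ x : Fin n → ℝ, φ x ≠ ⊤ ∧ ψ x ≠ ⊤)
    (hcoer : ∀ M : ℝ, ∃ R : ℝ, ∀ d : Fin n → ℝ, R ≤ ‖d‖ →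
      (M : EReal) ≤ φ d - ((∑ i, d i * t i : ℝ) : EReal) + ψ d) :
    (∃ dhat : Fin n → ℝ, ∀ d : Fin n → ℝ,
        φ dhat - ((∑ i, dhat i * t i : ℝ) : EReal) + ψ dhat
          ≤ φ d - ((∑ i, d i * t i : ℝ) : EReal) + ψ d) ∧
    (∀ dhat : Fin n → ℝ,
      (∀ d : Fin n → ℝ,
        φ dhat - ((∑ i, dhat i * t i : ℝ) : EReal) + ψ dhat
          ≤ φ d - ((∑ i, d i * t i : ℝ) : EReal) + ψ d) →
      (U * Matrix.diagonal dhat * Uᵀ).IsSymm ∧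
      (∀ C : Matrix (Fin n) (Fin n) ℝ, C.IsSymm →
        f (U * Matrix.diagonal dhat * Uᵀ)
            - (((T * (U * Matrix.diagonal dhat * Uᵀ)).trace : ℝ) : EReal)
            + g₀ (U * Matrix.diagonal dhat * Uᵀ)
          ≤ f C - (((T * C).trace : ℝ) : EReal) + g₀ C) ∧
      f (U * Matrix.diagonal dhat * Uᵀ)
          - (((T * (U * Matrix.diagonal dhat * Uᵀ)).trace : ℝ) : EReal)
          + g₀ (U * Matrix.diagonal dhat * Uᵀ)
        = φ dhat - ((∑ i, dhat i * t i : ℝ) : EReal) + ψ dhat) := by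
  refine ⟨aux_min t φ ψ hφp hψp hφl hψl hdom hcoer, fun dhat hd => ?_⟩
  have hE : IsEigVec (U * Matrix.diagonal dhat * Uᵀ) dhat := ⟨U, hU, rfl⟩
  have htr : (T * (U * Matrix.diagonal dhat * Uᵀ)).trace = ∑ i, dhat i * t i := by
    rw [hTdec, aux_trace, show Uᵀ * U = 1 from hU]
    refine Finset.sum_congr rfl fun i _ => ?_
    rw [Finset.sum_eq_single i]
    · simp [mul_comm]
    · intro j _ hj
      simp [Matrix.one_apply, hj.symm]
    · simp
  have heq : f (U * Matrix.diagonal dhat * Uᵀ)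
          - (((T * (U * Matrix.diagonal dhat * Uᵀ)).trace : ℝ) : EReal)
          + g₀ (U * Matrix.diagonal dhat * Uᵀ)
        = φ dhat - ((∑ i, dhat i * t i : ℝ) : EReal) + ψ dhat := by
    rw [htr, hf.2 _ _ hE, hg.2 _ _ hE]
  refine ⟨?_, fun C hC => ?_, heq⟩
  · simp [Matrix.IsSymm, Matrix.transpose_mul, Matrix.mul_assoc]
  · rw [heq]
    obtain ⟨d, hCd⟩ := aux_spec C hC
    rw [hf.2 _ _ hCd, hg.2 _ _ hCd]
    obtain ⟨V, hV, rfl⟩ := hCd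
    have hUU : U * Uᵀ = 1 := mul_eq_one_comm.mp hU
    have hW : (Uᵀ * V)ᵀ * (Uᵀ * V) = 1 := by
      rw [Matrix.transpose_mul, Matrix.transpose_transpose, Matrix.mul_assoc,
        ← Matrix.mul_assoc U, hUU, Matrix.one_mul]
      exact hV
    obtain ⟨σ, hσ⟩ := aux_birk (Uᵀ * V) hW t d
    refine (hd (d ∘ σ)).trans ?_
    rw [hf.1, hg.1, hTdec, aux_trace]
    exact add_le_add (EReal.sub_le_sub le_rfl (EReal.coe_le_coe_iff.2 hσ)) le_rfl
end
end

section
/- Let n be a positive integer and let f be the spectral function on S_n associated with a function φ : ℝⁿ → (−∞,+∞]. Let C ∈ S_n and let d ∈ ℝⁿ be a vector of eigenvalues of C. Then: (i) C ∈ dom f if and only if d ∈ dom φ; (ii) C belongs to the interior of dom f (interior taken in S_n with the Frobenius-norm topology) if and only if d belongs to the interior of dom φ in ℝⁿ. -/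
open Matrix Filter Topology Set

noncomputable section

lemma aux_perm {n : ℕ} {d d' : Fin n → ℝ}
    (h : (Finset.univ.val.map d) = (Finset.univ.val.map d')) :
    ∃ σ : Equiv.Perm (Fin n), d' ∘ σ = d := by
  classical
  have hc : ∀ c : ℝ, Nonempty ({i // d i = c} ≃ {i // d' i = c}) := by
    intro c
    refine ⟨Fintype.equivOfCardEq ?_⟩
    have h1 := congrArg (Multiset.count c) h
    rw [Multiset.count_map, Multiset.count_map] at h1
    rw [Fintype.card_subtype, Fintype.card_subtype]
    simp only [Finset.card, Finset.filter_val]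
    simpa only [eq_comm (a := c)] using h1
  let e := fun c => (hc c).some
  exact ⟨Equiv.ofFiberEquiv e, funext fun a => Equiv.ofFiberEquiv_map e a⟩

lemma aux_orth' {n : ℕ} {U : Matrix (Fin n) (Fin n) ℝ} (h : IsOrth U) : U * Uᵀ = 1 :=
  mul_eq_one_comm.mp h

lemma aux_roots {n : ℕ} {C : Matrix (Fin n) (Fin n) ℝ} {d : Fin n → ℝ} (h : IsEigVec C d) :
    C.charpoly.roots = Finset.univ.val.map d := by
  obtain ⟨U, hU, rfl⟩ := h
  have hU' : Uᵀ * U = 1 := hU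
  rw [Matrix.charpoly_mul_comm, ← mul_assoc, hU', one_mul, Matrix.charpoly_diagonal]
  have := Polynomial.roots_multiset_prod_X_sub_C (Finset.univ.val.map d)
  rw [Multiset.map_map] at this
  exact this

lemma aux_exists {n : ℕ} {C : Matrix (Fin n) (Fin n) ℝ} (h : C.IsSymm) :
    ∃ d, IsEigVec C d := by
  have hC : C.IsHermitian := isHermitian_iff_isSymm.mpr h
  refine ⟨hC.eigenvalues, (hC.eigenvectorUnitary : Matrix (Fin n) (Fin n) ℝ), ?_, ?_⟩
  · have := (Matrix.mem_unitaryGroup_iff').mp hC.eigenvectorUnitary.2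
    simpa [IsOrth, star_eq_conjTranspose] using this
  · have := hC.spectral_theorem
    rw [Unitary.conjStarAlgAut_apply] at this
    simpa [star_eq_conjTranspose, Function.comp_def] using this

lemma aux_bound {n : ℕ} {U : Matrix (Fin n) (Fin n) ℝ} (hU : IsOrth U) (i j : Fin n) :
    U i j ∈ Set.Icc (-1 : ℝ) 1 := by
  have hm : U ∈ Matrix.unitaryGroup (Fin n) ℝ := by
    rw [Matrix.mem_unitaryGroup_iff']
    simpa [IsOrth, star_eq_conjTranspose] using hU
  have := entry_norm_bound_of_unitary hm i j
  rw [Real.norm_eq_abs, abs_le] at this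
  exact this

lemma aux_compact {n : ℕ} : IsCompact {U : Matrix (Fin n) (Fin n) ℝ | IsOrth U} := by
  have hK : IsCompact (Set.pi Set.univ (fun _ : Fin n => Set.pi Set.univ
      (fun _ : Fin n => Set.Icc (-1 : ℝ) 1)) : Set (Matrix (Fin n) (Fin n) ℝ)) :=
    isCompact_univ_pi fun _ => isCompact_univ_pi fun _ => isCompact_Icc
  refine hK.of_isClosed_subset ?_ ?_
  · unfold IsOrth
    exact isClosed_eq (by fun_prop) continuous_const
  · intro U hU i _ j _
    exact aux_bound hU i j

lemma aux_entry {n : ℕ} (A : Matrix (Fin n) (Fin n) ℝ) (i j : Fin n) : |A i j| ≤ frobNorm A := by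
  apply Real.abs_le_sqrt
  unfold frobSq
  calc A i j ^ 2 ≤ ∑ j, A i j ^ 2 :=
        Finset.single_le_sum (f := fun j => A i j ^ 2) (fun _ _ => sq_nonneg _) (Finset.mem_univ j)
    _ ≤ _ := Finset.single_le_sum (f := fun i => ∑ j, A i j ^ 2)
        (fun _ _ => Finset.sum_nonneg fun _ _ => sq_nonneg _) (Finset.mem_univ i)

lemma aux_ball {n : ℕ} {V : Set (Matrix (Fin n) (Fin n) ℝ)} (hV : IsOpen V)
    {C : Matrix (Fin n) (Fin n) ℝ} (hC : C ∈ V) :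
    ∃ ρ > (0 : ℝ), ∀ C', frobNorm (C' - C) ≤ ρ → C' ∈ V := by
  obtain ⟨ε, hε, h⟩ := (Metric.isOpen_iff (α := Fin n → Fin n → ℝ)).mp hV C hC
  refine ⟨ε / 2, by positivity, fun C' hC' => h ?_⟩
  refine Metric.mem_ball.mpr ?_
  refine (dist_pi_lt_iff hε).mpr fun i => (dist_pi_lt_iff hε).mpr fun j => ?_
  have := aux_entry (C' - C) i j
  rw [Real.dist_eq]
  rw [Matrix.sub_apply] at this
  linarith

lemma aux_closed {n : ℕ} {B : Set (Fin n → ℝ)} (hB : IsClosed B) :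
    IsClosed {A : Matrix (Fin n) (Fin n) ℝ | ∃ x ∈ B, IsEigVec A x} := by
  have : CompactSpace {U : Matrix (Fin n) (Fin n) ℝ | IsOrth U} :=
    isCompact_iff_compactSpace.mp aux_compact
  let Z : Set ({U : Matrix (Fin n) (Fin n) ℝ | IsOrth U} × Matrix (Fin n) (Fin n) ℝ) :=
    {p | Matrix.diag ((p.1 : Matrix (Fin n) (Fin n) ℝ)ᵀ * p.2 * p.1.1) ∈ B ∧
      p.2 = p.1.1 * Matrix.diagonal
        (Matrix.diag ((p.1 : Matrix (Fin n) (Fin n) ℝ)ᵀ * p.2 * p.1.1)) *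
        (p.1 : Matrix (Fin n) (Fin n) ℝ)ᵀ}
  have hc : Continuous fun p : {U : Matrix (Fin n) (Fin n) ℝ | IsOrth U} ×
      Matrix (Fin n) (Fin n) ℝ => (p.1 : Matrix (Fin n) (Fin n) ℝ) :=
    continuous_subtype_val.comp continuous_fst
  have hd : Continuous fun p : {U : Matrix (Fin n) (Fin n) ℝ | IsOrth U} ×
      Matrix (Fin n) (Fin n) ℝ =>
        Matrix.diag ((p.1 : Matrix (Fin n) (Fin n) ℝ)ᵀ * p.2 * p.1.1) :=
    ((hc.matrix_transpose.matrix_mul continuous_snd).matrix_mul hc).matrix_diag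
  have hZ : IsClosed Z :=
    (hB.preimage hd).inter (isClosed_eq continuous_snd
      ((hc.matrix_mul hd.matrix_diagonal).matrix_mul hc.matrix_transpose))
  convert isClosedMap_snd_of_compactSpace _ hZ using 1
  ext A
  constructor
  · rintro ⟨x, hx, U, hU, rfl⟩
    have hU' : Uᵀ * U = 1 := hU
    have hk : Uᵀ * (U * Matrix.diagonal x * Uᵀ) * U = Matrix.diagonal x := by
      calc _ = (Uᵀ * U) * Matrix.diagonal x * (Uᵀ * U) := by simp only [mul_assoc]
        _ = _ := by rw [hU', one_mul, mul_one]
    refine ⟨(⟨U, hU⟩, _), ⟨?_, ?_⟩, rfl⟩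
    · simp only [hk, Matrix.diag_diagonal]; exact hx
    · simp only [hk, Matrix.diag_diagonal]
  · rintro ⟨⟨U, A'⟩, ⟨h1, h2⟩, rfl⟩
    exact ⟨_, h1, U.1, U.2, h2⟩

/-- Lemma 3 of the paper. Let `f` be the spectral function associated with `φ`,
`C` symmetric with eigenvalue vector `d`. Then (i) `C ∈ dom f ↔ d ∈ dom φ`; (ii) `C` is in the
interior of `dom f` relative to the space of symmetric matrices with the Frobenius norm iff
`d` is in the interior of `dom φ` in `ℝⁿ`. -/
theorem stmt2 (n : ℕ) (hn : 0 < n)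
    (f : Matrix (Fin n) (Fin n) ℝ → EReal) (φ : (Fin n → ℝ) → EReal)
    (hf : IsSpectral f φ)
    (C : Matrix (Fin n) (Fin n) ℝ) (d : Fin n → ℝ) (hd : IsEigVec C d) :
    (f C ≠ ⊤ ↔ φ d ≠ ⊤) ∧
    ((∃ ρ > (0 : ℝ), ∀ C' : Matrix (Fin n) (Fin n) ℝ, C'.IsSymm →
        frobNorm (C' - C) ≤ ρ → f C' ≠ ⊤)
      ↔ d ∈ interior {x : Fin n → ℝ | φ x ≠ ⊤}) := by
  have h1 := hf.2 C d hd
  refine ⟨by rw [h1], ?_, ?_⟩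
  · rintro ⟨ρ, hρ, h⟩
    obtain ⟨U, hU, rfl⟩ := hd
    have hcont : Continuous fun x : Fin n → ℝ =>
        frobNorm (U * Matrix.diagonal x * Uᵀ - U * Matrix.diagonal d * Uᵀ) := by
      have hm : Continuous fun x : Fin n → ℝ =>
        (U * Matrix.diagonal x * Uᵀ - U * Matrix.diagonal d * Uᵀ) := by fun_prop
      unfold frobNorm frobSq
      refine Real.continuous_sqrt.comp ?_
      exact continuous_finsetSum _ fun i _ => continuous_finsetSum _ fun j _ =>
        (hm.matrix_elem i j).pow 2
    refine mem_interior.mpr ⟨_, ?_, isOpen_lt hcont (continuous_const (y := ρ)), ?_⟩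
    · intro x hx
      have := h (U * Matrix.diagonal x * Uᵀ) ?_ (le_of_lt hx)
      · rw [hf.2 _ x ⟨U, hU, rfl⟩] at this
        exact this
      · simp [Matrix.IsSymm, Matrix.transpose_mul, mul_assoc]
    · simp [frobNorm, frobSq, hρ]
  · intro hi
    have hcl := aux_closed (n := n) (B := (interior {x : Fin n → ℝ | φ x ≠ ⊤})ᶜ)
      isOpen_interior.isClosed_compl
    obtain ⟨ρ, hρ, h⟩ := aux_ball (C := C) hcl.isOpen_compl (by
      rintro ⟨x, hx, hCx⟩
      apply hx
      obtain ⟨σ, hσ⟩ := aux_perm ((aux_roots hCx).symm.trans (aux_roots hd))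
      have hc : Continuous fun y : Fin n → ℝ => y ∘ σ.symm := by fun_prop
      refine mem_interior.mpr ⟨(fun y : Fin n → ℝ => y ∘ σ.symm) ⁻¹'
        interior {x : Fin n → ℝ | φ x ≠ ⊤}, ?_, isOpen_interior.preimage hc, ?_⟩
      · intro y hy
        have := interior_subset hy
        rw [mem_setOf_eq, hf.1] at this
        exact this
      · have : x ∘ σ.symm = d := by
          rw [← hσ]; ext i; simp
        rw [mem_preimage, this]
        exact hi)
    refine ⟨ρ, hρ, fun C' hs hC' => ?_⟩
    obtain ⟨x, hx⟩ := aux_exists hs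
    rw [hf.2 C' x hx]
    by_contra hbad
    exact h C' hC' ⟨x, fun hxi => interior_subset hxi hbad, hx⟩
end
end

section
/- Let n be a positive integer, γ > 0, and let C̄, T ∈ S_n. Let f and g₀ be the spectral functions on S_n associated with φ ∈ Γ0(ℝⁿ) and ψ ∈ Γ0(ℝⁿ), both invariant under permutations of coordinates, with dom φ ∩ dom ψ ≠ ∅. Let λ ∈ ℝⁿ and let U be an orthogonal matrix with C̄ + γT = U Diag(λ) Uᵀ. Then the function x ↦ γ(φ(x) + ψ(x)) + ½‖x − λ‖² has a unique minimizer prox_{γ(φ+ψ)}(λ) over ℝⁿ, the function C ↦ γ(f(C) − tr(TC) + g₀(C)) + ½‖C − C̄‖_F² has a unique minimizer over S_n, and this matrix minimizer equals U Diag(prox_{γ(φ+ψ)}(λ)) Uᵀ. -/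
open Matrix Filter Topology Set

noncomputable section

theorem h_lift {a : EReal} (h1 : a ≠ ⊤) (h2 : a ≠ ⊥) : ∃ r : ℝ, a = (r : EReal) :=
  ⟨a.toReal, (EReal.coe_toReal h1 h2).symm⟩

theorem prox_aux {n : ℕ} (h : (Fin n → ℝ) → EReal) (hbot : ∀ x, h x ≠ ⊥)
    (x0 : Fin n → ℝ) (hx0 : h x0 ≠ ⊤) (hlsc : LowerSemicontinuous h)
    (hconv : ∀ (x y : Fin n → ℝ) (r s a b : ℝ), 0 ≤ a → 0 ≤ b → a + b = 1 →
      h x = (r : EReal) → h y = (s : EReal) →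
      h (a • x + b • y) ≤ ((a * r + b * s : ℝ) : EReal))
    (γ : ℝ) (hγ : 0 < γ) (lam : Fin n → ℝ) :
    ∃ (lhat : Fin n → ℝ) (t0 : ℝ), h lhat = (t0 : EReal) ∧
      (∀ (x : Fin n → ℝ) (t : ℝ), h x = (t : EReal) →
        γ * t0 + (∑ i, (lhat i - lam i) ^ 2) / 2 ≤ γ * t + (∑ i, (x i - lam i) ^ 2) / 2) ∧
      (∀ (x : Fin n → ℝ) (t : ℝ), h x = (t : EReal) →
        γ * t + (∑ i, (x i - lam i) ^ 2) / 2 ≤ γ * t0 + (∑ i, (lhat i - lam i) ^ 2) / 2 →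
        x = lhat) := by
  obtain ⟨c, hc⟩ := h_lift hx0 (hbot x0)
  set q : (Fin n → ℝ) → ℝ := fun x => (∑ i, (x i - lam i) ^ 2) / 2 with hq
  have hq0 : ∀ x, 0 ≤ q x := fun x => by simp only [hq]; positivity
  have hqn : ∀ x, ‖x - lam‖ ^ 2 / 2 ≤ q x := by
    intro x
    have h1 : ‖x - lam‖ ≤ Real.sqrt (∑ i, (x i - lam i) ^ 2) := by
      rw [pi_norm_le_iff_of_nonneg (Real.sqrt_nonneg _)]
      intro i
      rw [Real.norm_eq_abs]
      apply Real.abs_le_sqrt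
      exact Finset.single_le_sum (f := fun i => (x i - lam i) ^ 2) (fun j _ => sq_nonneg _)
        (Finset.mem_univ i)
    have h2 : ‖x - lam‖ ^ 2 ≤ (∑ i, (x i - lam i) ^ 2) := by
      have := pow_le_pow_left₀ (norm_nonneg _) h1 2
      rwa [Real.sq_sqrt (Finset.sum_nonneg fun j _ => sq_nonneg _)] at this
    simp only [hq]; linarith
  -- lower bound
  obtain ⟨z, hz, hzmin⟩ := LowerSemicontinuousOn.exists_isMinOn (f := h)
    (s := Metric.closedBall x0 1) ⟨x0, by simp⟩ (isCompact_closedBall x0 1)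
    (hlsc.lowerSemicontinuousOn _)
  rw [isMinOn_iff] at hzmin
  have hzx0 := hzmin x0 (by simp)
  obtain ⟨m, hm⟩ := h_lift (a := h z) (fun e => by rw [e, hc] at hzx0; simp at hzx0) (hbot z)
  have hmc : m ≤ c := by rw [hm, hc] at hzx0; exact_mod_cast hzx0
  have hlow : ∀ (x : Fin n → ℝ) (t : ℝ), h x = (t : EReal) → 1 ≤ ‖x - x0‖ →
      c - (c - m) * ‖x - x0‖ ≤ t := by
    intro x t hxt hr
    set r := ‖x - x0‖ with hrdef
    have hrpos : 0 < r := by linarith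
    have h1 := hconv x0 x c t (1 - 1 / r) (1 / r)
      (by rw [sub_nonneg, div_le_one hrpos]; exact hr) (by positivity) (by ring) hc hxt
    have hmem : (1 - 1 / r) • x0 + (1 / r) • x ∈ Metric.closedBall x0 1 := by
      rw [mem_closedBall_iff_norm]
      have : (1 - 1 / r) • x0 + (1 / r) • x - x0 = (1 / r) • (x - x0) := by
        ext i; simp; ring
      rw [this, norm_smul, ← hrdef, Real.norm_of_nonneg (by positivity)]
      rw [one_div, inv_mul_cancel₀ hrpos.ne']
    have h2 := (hzmin _ hmem).trans h1
    rw [hm] at h2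
    have h3 : m ≤ (1 - 1 / r) * c + 1 / r * t := by exact_mod_cast h2
    have h4 : r * m ≤ r * ((1 - 1 / r) * c + 1 / r * t) := by gcongr
    have h5 : r * ((1 - 1 / r) * c + 1 / r * t) = (r - 1) * c + t := by field_simp
    nlinarith
  set D := ‖x0 - lam‖ with hD
  have hD0 : 0 ≤ D := norm_nonneg _
  set R := 2 * (D + γ * (c - m)) + 2 * q x0 + 1 with hR
  have hgK : 0 ≤ γ * (c - m) := mul_nonneg hγ.le (by linarith)
  have hR1 : 1 ≤ R := by have := hq0 x0; linarith
  have hout : ∀ (x : Fin n → ℝ) (t : ℝ), h x = (t : EReal) → R ≤ ‖x - x0‖ →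
      γ * c + q x0 ≤ γ * t + q x := by
    intro x t hxt hr
    have h1 := hlow x t hxt (hR1.trans hr)
    have h2 := hqn x
    have h3 : ‖x - x0‖ - D ≤ ‖x - lam‖ := by
      have : ‖x - x0‖ ≤ ‖x - lam‖ + ‖x0 - lam‖ := by
        have := norm_sub_le (x - lam) (x0 - lam)
        simpa using this
      linarith
    set r := ‖x - x0‖ with hrdef
    have hq00 := hq0 x0
    have hrD : 0 ≤ r - D := by nlinarith
    have h4 : (r - D) ^ 2 ≤ ‖x - lam‖ ^ 2 := pow_le_pow_left₀ hrD h3 2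
    have h5 : γ * (c - (c - m) * r) ≤ γ * t := by gcongr
    have h6 : R * r ≤ r * r := by gcongr
    have h7 : q x0 ≤ q x0 * r := by
      have : 1 ≤ r := hR1.trans hr
      nlinarith
    have h8 : R * r = 2 * D * r + 2 * (γ * (c - m)) * r + 2 * (q x0 * r) + r := by rw [hR]; ring
    nlinarith
  -- existence
  have hqc : Continuous fun x => ((q x / γ : ℝ) : EReal) := by
    apply continuous_coe_real_ereal.comp
    simp only [hq]
    fun_prop
  have hHlsc : LowerSemicontinuous fun x => h x + ((q x / γ : ℝ) : EReal) := by
    apply LowerSemicontinuous.add' hlsc hqc.lowerSemicontinuous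
    intro x
    exact EReal.continuousAt_add (Or.inr (by simp)) (Or.inr (by simp))
  obtain ⟨l, hl, hlmin⟩ := LowerSemicontinuousOn.exists_isMinOn
    (s := Metric.closedBall x0 R) ⟨x0, by simp; linarith⟩ (isCompact_closedBall x0 R)
    (hHlsc.lowerSemicontinuousOn _)
  rw [isMinOn_iff] at hlmin
  have hl0 := hlmin x0 (by simp; linarith)
  obtain ⟨t0, ht0⟩ := h_lift (a := h l) (fun e => by
    rw [e, hc, ← EReal.coe_add, EReal.top_add_coe] at hl0
    exact absurd (top_le_iff.1 hl0) (EReal.coe_ne_top _)) (hbot l)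
  have hin : ∀ (x : Fin n → ℝ) (t : ℝ), h x = (t : EReal) → ‖x - x0‖ ≤ R →
      γ * t0 + q l ≤ γ * t + q x := by
    intro x t hxt hr
    have h1 := hlmin x (by rwa [mem_closedBall_iff_norm])
    simp only [ht0, hxt] at h1
    have h2 : t0 + q l / γ ≤ t + q x / γ := by exact_mod_cast h1
    have h3 : γ * (t0 + q l / γ) ≤ γ * (t + q x / γ) := by gcongr
    have h4 : ∀ a b : ℝ, γ * (a + b / γ) = γ * a + b := fun a b => by field_simp
    rwa [h4, h4] at h3
  have hmin : ∀ (x : Fin n → ℝ) (t : ℝ), h x = (t : EReal) →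
      γ * t0 + q l ≤ γ * t + q x := by
    intro x t hxt
    rcases le_total ‖x - x0‖ R with hr | hr
    · exact hin x t hxt hr
    · exact (hin x0 c hc (by simp; linarith)).trans (hout x t hxt hr)
  refine ⟨l, t0, ht0, hmin, ?_⟩
  intro x t hxt hle
  have h1 := hconv x l t t0 (1/2) (1/2) (by norm_num) (by norm_num) (by norm_num) hxt ht0
  obtain ⟨s, hs⟩ := h_lift (a := h ((1/2 : ℝ) • x + (1/2 : ℝ) • l))
    (fun e => by rw [e] at h1; exact absurd (top_le_iff.1 h1) (EReal.coe_ne_top _)) (hbot _)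
  have h2 := hmin _ s hs
  have h3 : s ≤ 1 / 2 * t + 1 / 2 * t0 := by rw [hs] at h1; exact_mod_cast h1
  have h4 : q ((1/2 : ℝ) • x + (1/2 : ℝ) • l) =
      q x / 2 + q l / 2 - (∑ i, (x i - l i) ^ 2) / 8 := by
    simp only [hq, Finset.sum_div, ← Finset.sum_add_distrib, ← Finset.sum_sub_distrib]
    apply Finset.sum_congr rfl
    intro i _
    simp; ring
  have h5 : γ * s ≤ γ * (1 / 2 * t + 1 / 2 * t0) := by gcongr
  have hle' : γ * t + q x ≤ γ * t0 + q l := hle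
  have h6 : ∑ i, (x i - l i) ^ 2 ≤ 0 := by nlinarith
  have h7 := (Finset.sum_eq_zero_iff_of_nonneg (fun i _ => sq_nonneg (x i - l i))).1
    (le_antisymm h6 (Finset.sum_nonneg fun i _ => sq_nonneg _))
  ext i
  have := h7 i (Finset.mem_univ i)
  have := pow_eq_zero_iff (two_ne_zero) |>.1 this
  linarith

theorem birk_aux {n : ℕ} (W : Matrix (Fin n) (Fin n) ℝ) (h1 : Wᵀ * W = 1) (h2 : W * Wᵀ = 1) :
    ∃ w : Equiv.Perm (Fin n) → ℝ, (∀ σ, 0 ≤ w σ) ∧ ∑ σ, w σ = 1 ∧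
      (∀ d lam : Fin n → ℝ, ∑ i, ∑ j, W i j ^ 2 * (d j - lam i) ^ 2
        = ∑ σ, w σ * ∑ i, (d (σ i) - lam i) ^ 2) ∧
      (∀ i j, W i j ≠ 0 → ∃ σ, 0 < w σ ∧ σ i = j) := by
  have hS : (Matrix.of fun i j => W i j ^ 2) ∈ doublyStochastic ℝ (Fin n) := by
    rw [mem_doublyStochastic_iff_sum]
    refine ⟨fun i j => sq_nonneg _, fun i => ?_, fun j => ?_⟩
    · have := congrFun (congrFun h2 i) i
      simpa [Matrix.mul_apply, pow_two] using this
    · have := congrFun (congrFun h1 j) j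
      simpa [Matrix.mul_apply, pow_two] using this
  obtain ⟨w, hw0, hw1, hw⟩ := exists_eq_sum_perm_of_mem_doublyStochastic hS
  have key : ∀ i j, W i j ^ 2 = ∑ σ, w σ * (if σ i = j then 1 else 0) := by
    intro i j
    have := congrFun (congrFun hw i) j
    simp only [Matrix.sum_apply, Matrix.smul_apply, PEquiv.toMatrix_apply, Matrix.of_apply,
      smul_eq_mul] at this
    rw [← this]
    apply Finset.sum_congr rfl
    intro σ _
    simp [Equiv.toPEquiv_apply, eq_comm]
  refine ⟨w, hw0, hw1, ?_, ?_⟩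
  · intro d lam
    simp_rw [key, Finset.sum_mul, Finset.mul_sum]
    have : ∀ i : Fin n, ∑ j, ∑ σ, w σ * (if σ i = j then 1 else 0) * (d j - lam i) ^ 2
        = ∑ σ, w σ * (d (σ i) - lam i) ^ 2 := by
      intro i
      rw [Finset.sum_comm]
      apply Finset.sum_congr rfl
      intro σ _
      simp
    simp_rw [this]
    rw [Finset.sum_comm]
  · intro i j hij
    by_contra! hcon
    apply hij
    have : W i j ^ 2 = 0 := by
      rw [key]
      apply Finset.sum_eq_zero
      intro σ _
      by_cases hσ : σ i = j
      · have h3 : w σ = 0 := by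
          by_contra h4
          exact hcon σ (lt_of_le_of_ne (hw0 σ) (Ne.symm h4)) hσ
        simp [h3]
      · simp [hσ]
    exact pow_eq_zero_iff (two_ne_zero) |>.1 this

theorem frobSq_eq_trace {n : ℕ} (A : Matrix (Fin n) (Fin n) ℝ) :
    frobSq A = (Aᵀ * A).trace := by
  simp only [frobSq, Matrix.trace, Matrix.diag, Matrix.mul_apply, Matrix.transpose_apply, pow_two]
  rw [Finset.sum_comm]

theorem frobSq_conj {n : ℕ} (U V A : Matrix (Fin n) (Fin n) ℝ) (hU : U * Uᵀ = 1)
    (hV : V * Vᵀ = 1) : frobSq (Uᵀ * A * V) = frobSq A := by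
  rw [frobSq_eq_trace, frobSq_eq_trace]
  have : (Uᵀ * A * V)ᵀ * (Uᵀ * A * V) = Vᵀ * (Aᵀ * (U * Uᵀ) * A * V) := by
    simp only [Matrix.transpose_mul, Matrix.transpose_transpose, Matrix.mul_assoc]
  rw [this, Matrix.trace_mul_comm, hU, Matrix.mul_one, Matrix.mul_assoc, hV, Matrix.mul_one]

theorem frob_aux {n : ℕ} (U V : Matrix (Fin n) (Fin n) ℝ) (hU : Uᵀ * U = 1)
    (hV : Vᵀ * V = 1) (d lam : Fin n → ℝ) :
    frobSq (V * Matrix.diagonal d * Vᵀ - U * Matrix.diagonal lam * Uᵀ) =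
      ∑ i, ∑ j, (Uᵀ * V) i j ^ 2 * (d j - lam i) ^ 2 := by
  rw [← frobSq_conj U V _ (mul_eq_one_comm.1 hU) (mul_eq_one_comm.1 hV)]
  have : Uᵀ * (V * Matrix.diagonal d * Vᵀ - U * Matrix.diagonal lam * Uᵀ) * V =
      (Uᵀ * V) * Matrix.diagonal d - Matrix.diagonal lam * (Uᵀ * V) := by
    calc _ = (Uᵀ * V) * Matrix.diagonal d * (Vᵀ * V)
          - (Uᵀ * U) * Matrix.diagonal lam * (Uᵀ * V) := by noncomm_ring
      _ = _ := by rw [hU, hV, Matrix.mul_one, Matrix.one_mul]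
  rw [this, frobSq]
  apply Finset.sum_congr rfl; intro i _
  apply Finset.sum_congr rfl; intro j _
  rw [Matrix.sub_apply, Matrix.mul_diagonal, Matrix.diagonal_mul]
  ring

theorem shift_aux {n : ℕ} (γ : ℝ) (B T C : Matrix (Fin n) (Fin n) ℝ) (hC : C.IsSymm) :
    frobSq (C - B) / 2 - γ * (T * C).trace =
      frobSq (C - (B + γ • T)) / 2 + (frobSq B - frobSq (B + γ • T)) / 2 := by
  have h1 : (T * C).trace = ∑ i, ∑ j, T i j * C i j := by
    simp only [Matrix.trace, Matrix.diag, Matrix.mul_apply]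
    apply Finset.sum_congr rfl; intro i _
    apply Finset.sum_congr rfl; intro j _
    rw [hC.apply]
  rw [h1]
  simp only [frobSq, Finset.mul_sum, Finset.sum_div, ← Finset.sum_add_distrib,
    ← Finset.sum_sub_distrib]
  apply Finset.sum_congr rfl; intro i _
  apply Finset.sum_congr rfl; intro j _
  simp only [Matrix.sub_apply, Matrix.add_apply, Matrix.smul_apply, smul_eq_mul]
  ring

theorem eig_exists {n : ℕ} (C : Matrix (Fin n) (Fin n) ℝ) (hC : C.IsSymm) :
    ∃ V d, Vᵀ * V = 1 ∧ C = V * Matrix.diagonal d * Vᵀ := by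
  have hH : C.IsHermitian := by
    rw [Matrix.IsHermitian, Matrix.conjTranspose_eq_transpose_of_trivial]; exact hC
  refine ⟨hH.eigenvectorUnitary, hH.eigenvalues, ?_, ?_⟩
  · have := Unitary.coe_star_mul_self hH.eigenvectorUnitary
    rwa [Matrix.star_eq_conjTranspose, Matrix.conjTranspose_eq_transpose_of_trivial] at this
  · have := hH.spectral_theorem
    rw [Unitary.conjStarAlgAut_apply, Matrix.star_eq_conjTranspose,
      Matrix.conjTranspose_eq_transpose_of_trivial] at this
    simpa [Function.comp_def] using this

theorem conv_aux {n : ℕ} (φ : (Fin n → ℝ) → EReal) (h : EConvex φ)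
    (x y : Fin n → ℝ) (r s a b : ℝ) (ha : 0 ≤ a) (hb : 0 ≤ b) (hab : a + b = 1)
    (hx : φ x = (r : EReal)) (hy : φ y = (s : EReal)) :
    φ (a • x + b • y) ≤ ((a * r + b * s : ℝ) : EReal) := by
  have := h x y a b ha hb hab
  rw [hx, hy] at this
  exact_mod_cast this

theorem sum_real {a b : EReal} {t : ℝ} (ha : a ≠ ⊥) (hb : b ≠ ⊥) (h : a + b = (t : EReal)) :
    ∃ r s : ℝ, a = (r : EReal) ∧ b = (s : EReal) ∧ t = r + s := by
  have ha' : a ≠ ⊤ := by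
    rintro rfl; rw [EReal.top_add_of_ne_bot hb] at h; exact EReal.coe_ne_top t h.symm
  have hb' : b ≠ ⊤ := by
    rintro rfl; rw [EReal.add_top_of_ne_bot ha] at h; exact EReal.coe_ne_top t h.symm
  obtain ⟨r, rfl⟩ := h_lift ha' ha
  obtain ⟨s, rfl⟩ := h_lift hb' hb
  exact ⟨r, s, rfl, rfl, by exact_mod_cast h.symm⟩

theorem top_or_real {a b : EReal} (ha : a ≠ ⊥) (hb : b ≠ ⊥) :
    (∃ r s : ℝ, a = (r : EReal) ∧ b = (s : EReal)) ∨
    (a + b = ⊤ ∧ ∀ t : ℝ, a - (t : EReal) + b = ⊤) := by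
  by_cases ha' : a = ⊤
  · right; subst ha'
    exact ⟨EReal.top_add_of_ne_bot hb, fun t => by
      rw [EReal.top_sub_coe, EReal.top_add_of_ne_bot hb]⟩
  by_cases hb' : b = ⊤
  · right; subst hb'
    refine ⟨EReal.add_top_of_ne_bot ha, fun t => ?_⟩
    obtain ⟨r, rfl⟩ := h_lift ha' ha
    rw [← EReal.coe_sub, EReal.coe_add_top]
  left
  obtain ⟨r, rfl⟩ := h_lift ha' ha
  obtain ⟨s, rfl⟩ := h_lift hb' hb
  exact ⟨r, s, rfl, rfl⟩

/-- Proposition 1(ii) of the paper. `γ > 0`, `C̄, T ∈ Sₙ`, `f`, `g₀` spectral with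
`φ, ψ ∈ Γ₀(ℝⁿ)`, `dom φ ∩ dom ψ ≠ ∅`, `C̄ + γT = U Diag(λ) Uᵀ`, `U` orthogonal. Then
`x ↦ γ(φ(x)+ψ(x)) + ½‖x−λ‖²` has a unique minimizer `λ̂`, the matrix objective
`C ↦ γ(f(C) − tr(TC) + g₀(C)) + ½‖C − C̄‖_F²` has a unique minimizer over symmetric matrices,
and the latter equals `U Diag(λ̂) Uᵀ`. -/
theorem stmt5 (n : ℕ) (hn : 0 < n) (γ : ℝ) (hγ : 0 < γ)
    (Cbar T : Matrix (Fin n) (Fin n) ℝ) (hCbar : Cbar.IsSymm) (hT : T.IsSymm)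
    (f g₀ : Matrix (Fin n) (Fin n) ℝ → EReal) (φ ψ : (Fin n → ℝ) → EReal)
    (hφ : Gamma0 φ) (hψ : Gamma0 ψ)
    (hf : IsSpectral f φ) (hg : IsSpectral g₀ ψ)
    (hdom : ∃ x : Fin n → ℝ, φ x ≠ ⊤ ∧ ψ x ≠ ⊤)
    (lam : Fin n → ℝ) (U : Matrix (Fin n) (Fin n) ℝ) (hU : IsOrth U)
    (hdec : Cbar + γ • T = U * Matrix.diagonal lam * Uᵀ) :
    ∃ lhat : Fin n → ℝ,
      (∀ x : Fin n → ℝ,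
        (γ : EReal) * (φ lhat + ψ lhat) + (((∑ i, (lhat i - lam i) ^ 2) / 2 : ℝ) : EReal)
          ≤ (γ : EReal) * (φ x + ψ x) + (((∑ i, (x i - lam i) ^ 2) / 2 : ℝ) : EReal)) ∧
      (∀ x : Fin n → ℝ,
        (∀ x' : Fin n → ℝ,
          (γ : EReal) * (φ x + ψ x) + (((∑ i, (x i - lam i) ^ 2) / 2 : ℝ) : EReal)
            ≤ (γ : EReal) * (φ x' + ψ x') + (((∑ i, (x' i - lam i) ^ 2) / 2 : ℝ) : EReal)) →
        x = lhat) ∧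
      (U * Matrix.diagonal lhat * Uᵀ).IsSymm ∧
      (∀ C : Matrix (Fin n) (Fin n) ℝ, C.IsSymm →
        (γ : EReal) * (f (U * Matrix.diagonal lhat * Uᵀ)
              - (((T * (U * Matrix.diagonal lhat * Uᵀ)).trace : ℝ) : EReal)
              + g₀ (U * Matrix.diagonal lhat * Uᵀ))
            + ((frobSq (U * Matrix.diagonal lhat * Uᵀ - Cbar) / 2 : ℝ) : EReal)
          ≤ (γ : EReal) * (f C - (((T * C).trace : ℝ) : EReal) + g₀ C)
            + ((frobSq (C - Cbar) / 2 : ℝ) : EReal)) ∧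
      (∀ C : Matrix (Fin n) (Fin n) ℝ, C.IsSymm →
        (∀ C' : Matrix (Fin n) (Fin n) ℝ, C'.IsSymm →
          (γ : EReal) * (f C - (((T * C).trace : ℝ) : EReal) + g₀ C)
              + ((frobSq (C - Cbar) / 2 : ℝ) : EReal)
            ≤ (γ : EReal) * (f C' - (((T * C').trace : ℝ) : EReal) + g₀ C')
              + ((frobSq (C' - Cbar) / 2 : ℝ) : EReal)) →
        C = U * Matrix.diagonal lhat * Uᵀ) := by
  have bφ := hφ.1.2
  have bψ := hψ.1.2
  obtain ⟨x0, hx0φ, hx0ψ⟩ := hdom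
  obtain ⟨c1, hc1⟩ := h_lift hx0φ (bφ x0)
  obtain ⟨c2, hc2⟩ := h_lift hx0ψ (bψ x0)
  obtain ⟨l, t0, ht0, hmin, huniq⟩ := prox_aux (fun x => φ x + ψ x)
    (fun x => by
      rcases top_or_real (bφ x) (bψ x) with ⟨r, s, h1, h2⟩ | ⟨h1, -⟩
      · simp only [h1, h2, ← EReal.coe_add]; exact EReal.coe_ne_bot _
      · simp [h1])
    x0 (by simp only [hc1, hc2, ← EReal.coe_add]; exact EReal.coe_ne_top _)
    (hφ.2.1.add' hψ.2.1 fun x => EReal.continuousAt_add (Or.inr (bψ x)) (Or.inl (bφ x)))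
    (fun x y r s a b ha hb hab hx hy => by
      obtain ⟨r1, r2, hr1, hr2, rfl⟩ := sum_real (bφ x) (bψ x) hx
      obtain ⟨s1, s2, hs1, hs2, rfl⟩ := sum_real (bφ y) (bψ y) hy
      have e1 := conv_aux φ hφ.2.2 x y r1 s1 a b ha hb hab hr1 hs1
      have e2 := conv_aux ψ hψ.2.2 x y r2 s2 a b ha hb hab hr2 hs2
      refine (add_le_add e1 e2).trans ?_
      rw [← EReal.coe_add, EReal.coe_le_coe_iff]
      linarith)
    γ hγ lam
  obtain ⟨p, q, hp, hq, rfl⟩ := sum_real (bφ l) (bψ l) ht0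
  have hγtop : (γ : EReal) * ⊤ = ⊤ := EReal.coe_mul_top_of_pos hγ
  have hsymm : ∀ (V : Matrix (Fin n) (Fin n) ℝ) d, (V * Matrix.diagonal d * Vᵀ).IsSymm := by
    intro V d
    simp [Matrix.IsSymm, Matrix.transpose_mul, Matrix.mul_assoc]
  set Chat := U * Matrix.diagonal l * Uᵀ with hChat
  set K := (frobSq Cbar - frobSq (Cbar + γ • T)) / 2 with hK
  set L := γ * (p + q) + (∑ i, (l i - lam i) ^ 2) / 2 with hL
  have hCs : Chat.IsSymm := hsymm U l
  have hfC : f Chat = (p : EReal) := by rw [hf.2 Chat l ⟨U, hU, rfl⟩, hp]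
  have hgC : g₀ Chat = (q : EReal) := by rw [hg.2 Chat l ⟨U, hU, rfl⟩, hq]
  have hUU : Uᵀ * U = 1 := hU
  have hUU' : U * Uᵀ = 1 := mul_eq_one_comm.1 hUU
  -- value of the matrix objective at Chat
  have hval : (γ : EReal) * (f Chat - (((T * Chat).trace : ℝ) : EReal) + g₀ Chat)
      + ((frobSq (Chat - Cbar) / 2 : ℝ) : EReal) = ((L + K : ℝ) : EReal) := by
    rw [hfC, hgC]
    have h1 := shift_aux γ Cbar T Chat hCs
    have h2 := frob_aux U U hUU hUU l lam
    rw [← hdec, hUU] at h2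
    have h3 : ∑ i, ∑ j, (1 : Matrix (Fin n) (Fin n) ℝ) i j ^ 2 * (l j - lam i) ^ 2
        = ∑ i, (l i - lam i) ^ 2 := by
      apply Finset.sum_congr rfl; intro i _
      rw [Finset.sum_eq_single i]
      · simp
      · intro j _ hj; simp [Matrix.one_apply_ne hj.symm]
      · simp
    rw [h3] at h2
    rw [← EReal.coe_sub, ← EReal.coe_add, ← EReal.coe_mul, ← EReal.coe_add]
    congr 1
    rw [h2] at h1
    rw [hL]
    linarith
  -- general
  have hgen : ∀ C : Matrix (Fin n) (Fin n) ℝ, C.IsSymm →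
      (γ : EReal) * (f C - (((T * C).trace : ℝ) : EReal) + g₀ C)
        + ((frobSq (C - Cbar) / 2 : ℝ) : EReal) = ⊤ ∨
      ∃ v : ℝ, (γ : EReal) * (f C - (((T * C).trace : ℝ) : EReal) + g₀ C)
        + ((frobSq (C - Cbar) / 2 : ℝ) : EReal) = (v : EReal) ∧ L + K ≤ v ∧
        (v ≤ L + K → C = Chat) := by
    intro C hC
    obtain ⟨V, d, hV, hCV⟩ := eig_exists C hC
    rw [hf.2 C d ⟨V, hV, hCV⟩, hg.2 C d ⟨V, hV, hCV⟩]
    rcases top_or_real (bφ d) (bψ d) with ⟨a, b, ha, hb⟩ | ⟨-, h⟩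
    swap
    · left; rw [h, hγtop, EReal.top_add_coe]
    right
    rw [ha, hb, ← EReal.coe_sub, ← EReal.coe_add, ← EReal.coe_mul, ← EReal.coe_add]
    refine ⟨_, rfl, ?_⟩
    have hVV' : V * Vᵀ = 1 := mul_eq_one_comm.1 hV
    have hW1 : (Uᵀ * V)ᵀ * (Uᵀ * V) = 1 := by
      calc _ = Vᵀ * (U * Uᵀ) * V := by
            simp only [Matrix.transpose_mul, Matrix.transpose_transpose, Matrix.mul_assoc]
        _ = 1 := by rw [hUU', Matrix.mul_one, hV]
    obtain ⟨w, hw0, hw1, hw, hwσ⟩ := birk_aux (Uᵀ * V) hW1 (mul_eq_one_comm.1 hW1)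
    have h1 := shift_aux γ Cbar T C hC
    have h2 := frob_aux U V hUU hV d lam
    rw [← hdec, ← hCV, hw d lam] at h2
    have hφσ : ∀ σ : Equiv.Perm (Fin n), φ (d ∘ σ) + ψ (d ∘ σ) = ((a + b : ℝ) : EReal) := by
      intro σ
      rw [hf.1 σ d, hg.1 σ d, ha, hb, EReal.coe_add]
    set Hσ : Equiv.Perm (Fin n) → ℝ :=
      fun σ => γ * (a + b) + (∑ i, (d (σ i) - lam i) ^ 2) / 2 with hHσ
    have hLσ : ∀ σ, L ≤ Hσ σ := fun σ => hmin (d ∘ σ) (a + b) (hφσ σ)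
    have hv : γ * (a - (T * C).trace + b) + frobSq (C - Cbar) / 2 = ∑ σ, w σ * Hσ σ + K := by
      have e1 : ∑ σ, w σ * Hσ σ = γ * (a + b) +
          (∑ σ, w σ * ∑ i, (d (σ i) - lam i) ^ 2) / 2 := by
        simp only [hHσ, mul_add, Finset.sum_add_distrib, ← Finset.sum_mul, hw1, Finset.sum_div]
        rw [one_mul, one_mul]
        congr 1
        apply Finset.sum_congr rfl; intro σ _
        rw [mul_div_assoc, Finset.sum_div]
      rw [e1, ← h2]
      linarith
    rw [hv]
    have hLsum : L = ∑ σ, w σ * L := by rw [← Finset.sum_mul, hw1, one_mul]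
    have hle : ∀ σ ∈ Finset.univ, w σ * L ≤ w σ * Hσ σ :=
      fun σ _ => mul_le_mul_of_nonneg_left (hLσ σ) (hw0 σ)
    have hsum : L ≤ ∑ σ, w σ * Hσ σ := by
      calc L = ∑ σ, w σ * L := hLsum
        _ ≤ _ := Finset.sum_le_sum hle
    refine ⟨by linarith, fun hvle => ?_⟩
    have heq : ∑ σ, w σ * L = ∑ σ, w σ * Hσ σ := by rw [← hLsum]; linarith
    have hall := (Finset.sum_eq_sum_iff_of_le hle).1 heq
    have hdσ : ∀ σ, 0 < w σ → d ∘ σ = l := by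
      intro σ hσ
      have e := mul_left_cancel₀ hσ.ne' (hall σ (Finset.mem_univ σ))
      exact huniq (d ∘ σ) (a + b) (hφσ σ) e.ge
    have hcomm : (Uᵀ * V) * Matrix.diagonal d = Matrix.diagonal l * (Uᵀ * V) := by
      ext i j
      rw [Matrix.mul_diagonal, Matrix.diagonal_mul]
      by_cases h0 : (Uᵀ * V) i j = 0
      · rw [h0]; ring
      · obtain ⟨σ, hσ, hij⟩ := hwσ i j h0
        have := congrFun (hdσ σ hσ) i
        simp only [Function.comp_apply, hij] at this
        rw [this]; ring
    calc C = (U * Uᵀ) * V * Matrix.diagonal d * Vᵀ := by rw [hUU', Matrix.one_mul, hCV]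
      _ = U * ((Uᵀ * V) * Matrix.diagonal d) * Vᵀ := by simp only [Matrix.mul_assoc]
      _ = U * Matrix.diagonal l * Uᵀ * (V * Vᵀ) := by rw [hcomm]; simp only [Matrix.mul_assoc]
      _ = Chat := by rw [hVV', Matrix.mul_one]
  have hvl : (γ : EReal) * (φ l + ψ l) + (((∑ i, (l i - lam i) ^ 2) / 2 : ℝ) : EReal)
      = (L : EReal) := by
    rw [hp, hq, ← EReal.coe_add, ← EReal.coe_mul, ← EReal.coe_add]
  have hvx : ∀ x : Fin n → ℝ,
      (γ : EReal) * (φ x + ψ x) + (((∑ i, (x i - lam i) ^ 2) / 2 : ℝ) : EReal) = ⊤ ∨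
      ∃ v : ℝ, (γ : EReal) * (φ x + ψ x) + (((∑ i, (x i - lam i) ^ 2) / 2 : ℝ) : EReal)
        = (v : EReal) ∧ L ≤ v ∧ (v ≤ L → x = l) := by
    intro x
    rcases top_or_real (bφ x) (bψ x) with ⟨a, b, ha, hb⟩ | ⟨h, -⟩
    · right
      have e : φ x + ψ x = ((a + b : ℝ) : EReal) := by rw [ha, hb, EReal.coe_add]
      rw [e, ← EReal.coe_mul, ← EReal.coe_add]
      exact ⟨_, rfl, hmin x _ e, huniq x _ e⟩
    · left; rw [h, hγtop, EReal.top_add_coe]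
  refine ⟨l, ?_, ?_, hCs, ?_, ?_⟩
  · intro x
    rw [hvl]
    rcases hvx x with h | ⟨v, h, h1, -⟩
    · rw [h]; exact le_top
    · rw [h]; exact_mod_cast h1
  · intro x hx
    have h0 := hx l
    rw [hvl] at h0
    rcases hvx x with h | ⟨v, h, -, h1⟩
    · rw [h] at h0; exact absurd (top_le_iff.1 h0) (EReal.coe_ne_top _)
    · rw [h] at h0; exact h1 (by exact_mod_cast h0)
  · intro C hC
    rw [hval]
    rcases hgen C hC with h | ⟨v, h, h1, -⟩
    · rw [h]; exact le_top
    · rw [h]; exact_mod_cast h1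
  · intro C hC hx
    have h0 := hx Chat hCs
    rw [hval] at h0
    rcases hgen C hC with h | ⟨v, h, -, h1⟩
    · rw [h] at h0; exact absurd (top_le_iff.1 h0) (EReal.coe_ne_top _)
    · rw [h] at h0; exact h1 (by exact_mod_cast h0)
end
end

section
/- Let n be a positive integer and σ > 0. The function C ↦ log det(C⁻¹ + σ²I) is convex on the set of real symmetric positive definite n×n matrices (which is a convex subset of S_n). -/
open Matrix

theorem aux_log {n : ℕ} {Z : Matrix (Fin n) (Fin n) ℝ} (hZ : Z.PosDef) :
    Real.log Z.det ≤ Z.trace - n := by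
  rw [hZ.1.det_eq_prod_eigenvalues, hZ.1.trace_eq_sum_eigenvalues]
  simp only [RCLike.ofReal_real_eq_id, id]
  rw [Real.log_prod (fun i _ => (hZ.eigenvalues_pos i).ne')]
  have : ∑ i, Real.log (hZ.1.eigenvalues i) ≤ ∑ i, (hZ.1.eigenvalues i - 1) :=
    Finset.sum_le_sum fun i _ => Real.log_le_sub_one_of_pos (hZ.eigenvalues_pos i)
  simpa using this

open scoped MatrixOrder in
theorem aux_fac {n : ℕ} {W : Matrix (Fin n) (Fin n) ℝ} (hW : W.PosSemidef) :
    ∃ B : Matrix (Fin n) (Fin n) ℝ, W = Bᴴ * B := by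
  obtain ⟨B, hB⟩ := CStarAlgebra.nonneg_iff_eq_star_mul_self.mp hW.nonneg
  exact ⟨B, hB⟩

theorem aux_log2 {n : ℕ} {W X : Matrix (Fin n) (Fin n) ℝ} (hW : W.PosDef) (hX : X.PosDef) :
    Real.log W.det + Real.log X.det ≤ (W * X).trace - n := by
  obtain ⟨B, hB⟩ := aux_fac hW.posSemidef
  have h1 : (B * X * Bᴴ).det = W.det * X.det := by
    rw [hB]; simp only [det_mul]; ring
  have h2 : (B * X * Bᴴ).trace = (W * X).trace := by
    rw [hB, trace_mul_comm, mul_assoc]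
  have h3 : (B * X * Bᴴ).PosDef := by
    refine (hX.posSemidef.mul_mul_conjTranspose_same B).posDef_iff_det_ne_zero.mpr ?_
    rw [h1]; exact (mul_pos hW.det_pos hX.det_pos).ne'
  have := aux_log h3
  rwa [h1, h2, Real.log_mul hW.det_pos.ne' hX.det_pos.ne'] at this

theorem aux_tr {n : ℕ} {W X : Matrix (Fin n) (Fin n) ℝ} (hW : W.PosSemidef) (hX : X.PosSemidef) :
    0 ≤ (W * X).trace := by
  obtain ⟨B, hB⟩ := aux_fac hW
  have h2 : (B * X * Bᴴ).trace = (W * X).trace := by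
    rw [hB, trace_mul_comm, mul_assoc]
  rw [← h2]
  exact (hX.mul_mul_conjTranspose_same B).trace_nonneg

theorem aux_h {n : ℕ} {s : ℝ} (hs : 0 < s) {C : Matrix (Fin n) (Fin n) ℝ} (hC : C.PosDef) :
    (C⁻¹ + s • (1 : Matrix (Fin n) (Fin n) ℝ))⁻¹ = s⁻¹ • (1 - (1 + s • C)⁻¹) := by
  have hA : (1 + s • C).PosDef := PosDef.one.add (hC.smul hs)
  have hCu := hC.det_pos.ne'.isUnit
  have hAu := hA.det_pos.ne'.isUnit
  apply inv_eq_right_inv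
  have e1 : s⁻¹ • (1 - (1 + s • C)⁻¹) = C * (1 + s • C)⁻¹ := by
    have : (1 : Matrix (Fin n) (Fin n) ℝ) - (1 + s • C)⁻¹ = s • (C * (1 + s • C)⁻¹) := by
      rw [sub_eq_iff_eq_add, ← smul_mul_assoc]
      nth_rw 1 [← mul_nonsing_inv _ hAu]
      rw [add_mul, one_mul, add_comm]
    rw [this, smul_smul, inv_mul_cancel₀ hs.ne', one_smul]
  rw [e1, ← mul_assoc, add_mul, nonsing_inv_mul _ hCu, smul_mul_assoc, one_mul,
    mul_nonsing_inv _ hAu]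

theorem aux_tangent {n : ℕ} {s : ℝ} (hs : 0 < s) {C M : Matrix (Fin n) (Fin n) ℝ}
    (hC : C.PosDef) (hM : M.PosDef) :
    Real.log (M⁻¹ + s • (1 : Matrix (Fin n) (Fin n) ℝ)).det -
      ((M⁻¹ + s • (1 : Matrix (Fin n) (Fin n) ℝ)) *
        ((1 + s • M)⁻¹ * (C - M) * (1 + s • M)⁻¹)).trace
    ≤ Real.log (C⁻¹ + s • (1 : Matrix (Fin n) (Fin n) ℝ)).det := by
  have hV : (C⁻¹ + s • (1 : Matrix (Fin n) (Fin n) ℝ)).PosDef := hC.inv.add (PosDef.one.smul hs)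
  have hW : (M⁻¹ + s • (1 : Matrix (Fin n) (Fin n) ℝ)).PosDef := hM.inv.add (PosDef.one.smul hs)
  have eV := aux_h hs hC
  have eW := aux_h hs hM
  set V := C⁻¹ + s • (1 : Matrix (Fin n) (Fin n) ℝ)
  set W := M⁻¹ + s • (1 : Matrix (Fin n) (Fin n) ℝ)
  have hA : (1 + s • C).PosDef := PosDef.one.add (hC.smul hs)
  have hN : (1 + s • M).PosDef := PosDef.one.add (hM.smul hs)
  have hCM : C - M = s⁻¹ • ((1 + s • C) - (1 + s • M)) := by
    rw [add_sub_add_left_eq_sub, ← smul_sub, smul_smul, inv_mul_cancel₀ hs.ne', one_smul]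
  rw [hCM]
  set A := 1 + s • C
  set N := 1 + s • M
  have hAu := hA.det_pos.ne'.isUnit
  have hNu := hN.det_pos.ne'.isUnit
  have hP : (s⁻¹ • ((A⁻¹ - N⁻¹) * A * (A⁻¹ - N⁻¹)ᴴ)).PosSemidef :=
    (hA.posSemidef.mul_mul_conjTranspose_same _).smul (inv_pos.mpr hs).le
  have hP' : s⁻¹ • ((A⁻¹ - N⁻¹) * A * (A⁻¹ - N⁻¹)ᴴ)
      = W⁻¹ + N⁻¹ * (s⁻¹ • (A - N)) * N⁻¹ - V⁻¹ := by
    rw [eV, eW, conjTranspose_sub, hA.inv.1.eq, hN.inv.1.eq, mul_smul_comm, smul_mul_assoc,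
      ← smul_add, ← smul_sub]
    congr 1
    have a1 := nonsing_inv_mul _ hAu
    have a2 := mul_nonsing_inv _ hAu
    have a3 := nonsing_inv_mul _ hNu
    simp only [sub_mul, mul_sub, a1, a3, one_mul, mul_assoc, a2, mul_one]
    abel
  have h1 := aux_tr hW.posSemidef (hP' ▸ hP)
  have h2 := aux_log2 hW hV.inv
  rw [mul_sub, mul_add, trace_sub, trace_add, mul_nonsing_inv _ hW.det_pos.ne'.isUnit,
    trace_one, Fintype.card_fin] at h1
  rw [det_nonsing_inv, Ring.inverse_eq_inv', Real.log_inv] at h2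
  linarith

/-- For `σ > 0`, the function `C ↦ log det(C⁻¹ + σ²I)` is convex on the set of
real symmetric positive definite `n×n` matrices. -/
theorem stmt10 (n : ℕ) (hn : 0 < n) (σ : ℝ) (hσ : 0 < σ) :
    ConvexOn ℝ {C : Matrix (Fin n) (Fin n) ℝ | C.PosDef}
      (fun C => Real.log (C⁻¹ + σ ^ 2 • (1 : Matrix (Fin n) (Fin n) ℝ)).det) := by
  have hs : 0 < σ ^ 2 := by positivity
  have hconv : Convex ℝ {C : Matrix (Fin n) (Fin n) ℝ | C.PosDef} := by
    rw [convex_iff_forall_pos]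
    intro C hC D hD a b ha hb _
    exact (PosDef.smul hC ha).add (PosDef.smul hD hb)
  refine ⟨hconv, ?_⟩
  intro C hC D hD a b ha hb hab
  have hM := hconv hC hD ha hb hab
  have h1 := mul_le_mul_of_nonneg_left (aux_tangent hs hC hM) ha
  have h2 := mul_le_mul_of_nonneg_left (aux_tangent hs hD hM) hb
  simp only [smul_eq_mul]
  obtain ⟨M, hMe⟩ : ∃ M, M = a • C + b • D := ⟨_, rfl⟩
  rw [← hMe] at h1 h2 ⊢
  have h0 : a • (C - M) + b • (D - M) = 0 := by
    have : a • (C - M) + b • (D - M) = (a • C + b • D) - (a + b) • M := by module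
    rw [this, hab, one_smul, hMe, sub_self]
  generalize M⁻¹ + σ ^ 2 • (1 : Matrix (Fin n) (Fin n) ℝ) = W at *
  generalize (1 + σ ^ 2 • M)⁻¹ = K at *
  have h3 : a * (W * (K * (C - M) * K)).trace + b * (W * (K * (D - M) * K)).trace = 0 := by
    have : (W * (K * (a • (C - M) + b • (D - M)) * K)).trace = 0 := by
      rw [h0]; simp
    rw [← this]
    simp only [mul_add, add_mul, mul_smul_comm, smul_mul_assoc, trace_add, trace_smul, smul_eq_mul]
  have h4 : a * Real.log W.det + b * Real.log W.det = Real.log W.det := by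
    rw [← add_mul, hab, one_mul]
  linarith
end

section
/- Let n be a positive integer, σ > 0, and let S be a real symmetric positive semidefinite n×n matrix. Then the function T_S defined by T_S(C) = tr((I + σ²C)⁻¹ C S) is concave on the convex cone of real symmetric positive semidefinite n×n matrices. -/
open Matrix

open scoped MatrixOrder in
lemma aux_trace_s12 {n : ℕ} {M S : Matrix (Fin n) (Fin n) ℝ} (hM : M.PosSemidef)
    (hS : S.PosSemidef) : 0 ≤ (M * S).trace := by
  obtain ⟨B, rfl⟩ : ∃ B : Matrix (Fin n) (Fin n) ℝ, S = Bᴴ * B :=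
    CStarAlgebra.nonneg_iff_eq_star_mul_self.mp hS.nonneg
  rw [← Matrix.mul_assoc, Matrix.trace_mul_comm, ← Matrix.mul_assoc]
  exact (hM.mul_mul_conjTranspose_same B).trace_nonneg

lemma aux_var {n : ℕ} {X Z S : Matrix (Fin n) (Fin n) ℝ} (hX : X.PosDef)
    (hZ : Z.IsHermitian) (hS : S.PosSemidef) :
    2 * (Z * S).trace - (Z * X * Z * S).trace ≤ (X⁻¹ * S).trace := by
  have hu : IsUnit X.det := (Matrix.isUnit_iff_isUnit_det X).mp hX.isUnit
  have h1 : ((X⁻¹ - Z) * X * (X⁻¹ - Z)ᴴ).PosSemidef :=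
    hX.posSemidef.mul_mul_conjTranspose_same _
  have h2 : (X⁻¹ - Z)ᴴ = X⁻¹ - Z := (hX.isHermitian.inv.sub hZ)
  have h3 : (X⁻¹ - Z) * X * (X⁻¹ - Z) = X⁻¹ - Z - Z + Z * X * Z := by
    rw [sub_mul, Matrix.nonsing_inv_mul _ hu, mul_sub, sub_mul, sub_mul, Matrix.mul_assoc Z X X⁻¹,
      Matrix.mul_nonsing_inv _ hu]
    simp only [one_mul, mul_one]
    abel
  rw [h2, h3] at h1
  have := aux_trace_s12 h1 hS
  simp only [add_mul, sub_mul, Matrix.trace_add, Matrix.trace_sub] at this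
  linarith

lemma aux_pd {n : ℕ} {σ : ℝ} {C : Matrix (Fin n) (Fin n) ℝ} (hC : C.PosSemidef) :
    (1 + σ ^ 2 • C).PosDef :=
  Matrix.PosDef.one.add_posSemidef (hC.smul (sq_nonneg σ))

lemma aux_f {n : ℕ} {σ : ℝ} (hσ : 0 < σ) {C : Matrix (Fin n) (Fin n) ℝ} (hC : C.PosSemidef)
    (S : Matrix (Fin n) (Fin n) ℝ) :
    σ ^ 2 * ((1 + σ ^ 2 • C)⁻¹ * C * S).trace
      = S.trace - ((1 + σ ^ 2 • C)⁻¹ * S).trace := by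
  have hX := aux_pd (σ := σ) hC
  have hu : IsUnit (1 + σ ^ 2 • C).det := (Matrix.isUnit_iff_isUnit_det _).mp hX.isUnit
  have h := Matrix.nonsing_inv_mul _ hu
  generalize (1 + σ ^ 2 • C)⁻¹ = Y at *
  rw [mul_add, mul_one, Matrix.mul_smul] at h
  have h2 : S.trace = ((Y + σ ^ 2 • (Y * C)) * S).trace := by rw [h, one_mul]
  rw [h2, add_mul, Matrix.trace_add, Matrix.smul_mul, Matrix.trace_smul, smul_eq_mul]
  ring

/-- Lemma 6 of the paper. For `σ > 0` and `S` PSD, the function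
`T_S(C) = tr((I + σ²C)⁻¹ C S)` is concave on the convex cone of real symmetric positive
semidefinite matrices. -/
theorem stmt12 (n : ℕ) (hn : 0 < n) (σ : ℝ) (hσ : 0 < σ)
    (S : Matrix (Fin n) (Fin n) ℝ) (hS : S.PosSemidef) :
    ConcaveOn ℝ {C : Matrix (Fin n) (Fin n) ℝ | C.PosSemidef}
      (fun C => ((1 + σ ^ 2 • C)⁻¹ * C * S).trace) := by
  have hconv : ∀ C D : Matrix (Fin n) (Fin n) ℝ, C.PosSemidef → D.PosSemidef → ∀ a b : ℝ,
      0 ≤ a → 0 ≤ b → (a • C + b • D).PosSemidef := fun C D hC hD a b ha hb =>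
    (hC.smul ha).add (hD.smul hb)
  refine ⟨fun C hC D hD a b ha hb _ => hconv C D hC hD a b ha hb, ?_⟩
  intro C hC D hD a b ha hb hab
  have hC' : C.PosSemidef := hC
  have hD' : D.PosSemidef := hD
  have hE := hconv C D hC' hD' a b ha hb
  have hs : 0 < σ ^ 2 := by positivity
  refine le_of_mul_le_mul_left ?_ hs
  simp only [smul_eq_mul]
  rw [aux_f hσ hE, mul_add, mul_left_comm, aux_f hσ hC', mul_left_comm, aux_f hσ hD']
  have hX := aux_pd (σ := σ) hE
  have hu : IsUnit (1 + σ ^ 2 • (a • C + b • D)).det :=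
    (Matrix.isUnit_iff_isUnit_det _).mp hX.isUnit
  have hZ := hX.isHermitian.inv
  have h := Matrix.nonsing_inv_mul _ hu
  have e : 1 + σ ^ 2 • (a • C + b • D) = a • (1 + σ ^ 2 • C) + b • (1 + σ ^ 2 • D) := by
    have : (1 : Matrix (Fin n) (Fin n) ℝ) = a • 1 + b • 1 := by rw [← add_smul, hab, one_smul]
    nth_rw 1 [this]
    module
  have v1 := aux_var (aux_pd (σ := σ) hC') hZ hS
  have v2 := aux_var (aux_pd (σ := σ) hD') hZ hS
  generalize (1 + σ ^ 2 • (a • C + b • D))⁻¹ = Z at *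
  rw [e] at h
  have k : (Z * S).trace = a * (Z * (1 + σ ^ 2 • C) * Z * S).trace
      + b * (Z * (1 + σ ^ 2 • D) * Z * S).trace := by
    have : Z * S = (Z * (a • (1 + σ ^ 2 • C) + b • (1 + σ ^ 2 • D))) * Z * S := by
      rw [h, one_mul]
    rw [this, Matrix.mul_add, Matrix.mul_smul, Matrix.mul_smul, add_mul, add_mul,
      Matrix.trace_add]
    simp only [Matrix.smul_mul, Matrix.trace_smul, smul_eq_mul]
  have w1 := mul_le_mul_of_nonneg_left v1 ha
  have w2 := mul_le_mul_of_nonneg_left v2 hb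
  have hb' : b = 1 - a := by linarith
  subst hb'
  nlinarith
end

section
/- Let n be a positive integer, σ > 0, and let S be a real symmetric positive semidefinite n×n matrix. Then for every real symmetric positive semidefinite n×n matrix C and every real symmetric positive definite n×n matrix C', one has tr((I + σ²C)⁻¹ C S) ≤ tr((I + σ²C')⁻¹ C' S) + tr((I + σ²C')⁻¹ S (I + σ²C')⁻¹ (C − C')). -/
open Matrix

open scoped MatrixOrder in
theorem aux_factor {n : ℕ} (S : Matrix (Fin n) (Fin n) ℝ) (hS : S.PosSemidef) :
    ∃ D : Matrix (Fin n) (Fin n) ℝ, S = Dᴴ * D := by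
  obtain ⟨B, hB⟩ := CStarAlgebra.nonneg_iff_eq_star_mul_self.mp hS.nonneg
  exact ⟨B, hB⟩

/-- concavity inequality (34) of the paper. For `σ > 0`, `S` PSD, `C` PSD and
`C'` positive definite,
`tr((I+σ²C)⁻¹CS) ≤ tr((I+σ²C')⁻¹C'S) + tr((I+σ²C')⁻¹S(I+σ²C')⁻¹(C − C'))`. -/
theorem stmt13 (n : ℕ) (hn : 0 < n) (σ : ℝ) (hσ : 0 < σ)
    (S : Matrix (Fin n) (Fin n) ℝ) (hS : S.PosSemidef)
    (C C' : Matrix (Fin n) (Fin n) ℝ) (hC : C.PosSemidef) (hC' : C'.PosDef) :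
    ((1 + σ ^ 2 • C)⁻¹ * C * S).trace
      ≤ ((1 + σ ^ 2 • C')⁻¹ * C' * S).trace
        + ((1 + σ ^ 2 • C')⁻¹ * S * (1 + σ ^ 2 • C')⁻¹ * (C - C')).trace := by
  have hs : 0 < σ ^ 2 := by positivity
  generalize σ ^ 2 = s at hs ⊢
  have hM : (1 + s • C).PosDef := Matrix.PosDef.one.add_posSemidef (hC.smul hs.le)
  have hN : (1 + s • C').PosDef := Matrix.PosDef.one.add_posSemidef (hC'.posSemidef.smul hs.le)
  have hMd : IsUnit (1 + s • C).det := (Matrix.isUnit_iff_isUnit_det _).1 hM.isUnit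
  have hNd : IsUnit (1 + s • C').det := (Matrix.isUnit_iff_isUnit_det _).1 hN.isUnit
  have a1 := Matrix.nonsing_inv_mul _ hMd
  have a2 := Matrix.mul_nonsing_inv _ hMd
  have b1 := Matrix.nonsing_inv_mul _ hNd
  have b2 := Matrix.mul_nonsing_inv _ hNd
  have hA : (1 + s • C)⁻¹.IsHermitian := hM.isHermitian.inv
  have hB : (1 + s • C')⁻¹.IsHermitian := hN.isHermitian.inv
  have eC : s • C = (1 + s • C) - 1 := by abel
  have eC' : s • C' = (1 + s • C') - 1 := by abel
  generalize 1 + s • C = M at *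
  generalize 1 + s • C' = N at *
  generalize M⁻¹ = A at *
  generalize N⁻¹ = B at *
  have hP : ((A - B) * M * (A - B)).PosSemidef := by
    have := hM.posSemidef.conjTranspose_mul_mul_same (A - B)
    rwa [(hA.sub hB).eq] at this
  have hE : (A - B) * M * (A - B) = A - B - B + B * M * B := by
    have h1 : A * M * A = A := by rw [a1, one_mul]
    have h2 : A * M * B = B := by rw [a1, one_mul]
    have h3 : B * M * A = B := by rw [mul_assoc, a2, mul_one]
    simp only [sub_mul, mul_sub, h1, h2, h3]
    abel
  have key : 0 ≤ ((A - B) * M * (A - B) * S).trace := by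
    obtain ⟨D, rfl⟩ : ∃ D : Matrix (Fin n) (Fin n) ℝ, S = Dᴴ * D :=
      aux_factor S hS
    rw [← mul_assoc, Matrix.trace_mul_comm, ← mul_assoc]
    exact (hP.mul_mul_conjTranspose_same D).trace_nonneg
  rw [hE] at key
  have t1 : s * (A * C * S).trace = S.trace - (A * S).trace := by
    rw [← smul_eq_mul, ← Matrix.trace_smul, ← smul_mul_assoc, ← mul_smul_comm, eC, mul_sub, a1,
      mul_one, sub_mul, one_mul, Matrix.trace_sub]
  have t2 : s * (B * C' * S).trace = S.trace - (B * S).trace := by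
    rw [← smul_eq_mul, ← Matrix.trace_smul, ← smul_mul_assoc, ← mul_smul_comm, eC', mul_sub, b1,
      mul_one, sub_mul, one_mul, Matrix.trace_sub]
  have t3 : s * (B * S * B * (C - C')).trace = (B * M * B * S).trace - (B * S).trace := by
    rw [← smul_eq_mul, ← Matrix.trace_smul, ← mul_smul_comm, smul_sub, eC, eC',
      sub_sub_sub_cancel_right, mul_sub, Matrix.trace_sub, mul_assoc (B * S) B N, b1, mul_one]
    congr 1
    rw [mul_assoc (B * S), Matrix.trace_mul_comm, ← mul_assoc, Matrix.trace_mul_comm,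
      ← mul_assoc, Matrix.trace_mul_comm]
  simp only [add_mul, sub_mul, Matrix.trace_add, Matrix.trace_sub] at key
  refine le_of_mul_le_mul_left ?_ hs
  rw [mul_add, t1, t2, t3]
  linarith
end
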